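/- Every distance preservation game with symmetric preferences admits a swap stable allocation. -/

import Mathlib

open Finset

/-- A distance preservation game: a finite set of agents `A`, relationship sets `M a`,
ideal distance functions `d a`, and a topology `G` — a connected simple graph on a
finite vertex set `V` with at least as many vertices as agents. -/
structure DPG (A V : Type) [Fintype A] [DecidableEq A] [Fintype V] where
  G : SimpleGraph V
  conn : G.Connected
  M : A → Finset A
  M_irr : ∀ a : A, a ∉ M a
  d : A → A → ℕ
  d_pos : ∀ a b : A, b ∈ M a → 0 < d a b
  card_le : Fintype.card A ≤ Fintype.card V

variable {A V : Type} [Fintype A] [DecidableEq A] [Fintype V]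

/-- The cost of agent `a` under allocation `π`. -/
noncomputable def DPG.cost (Γ : DPG A V) (π : A → V) (a : A) : ℕ :=
  ∑ b ∈ Γ.M a, ((Γ.d a b : ℤ) - (Γ.G.dist (π a) (π b) : ℤ)).natAbs

/-- The allocation obtained from `π` by swapping the positions of `a` and `b`. -/
def swapAlloc (π : A → V) (a b : A) : A → V := π ∘ Equiv.swap a b

/-- An allocation is envy-free if no agent strictly decreases their cost by
taking the position of another agent. -/
def DPG.EnvyFree (Γ : DPG A V) (π : A → V) : Prop :=
  ∀ a b : A, a ≠ b → ¬ (Γ.cost π a > Γ.cost (swapAlloc π a b) a)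

/-- An allocation is swap stable if no pair of distinct agents both strictly decrease
their costs by swapping positions. -/
def DPG.SwapStable (Γ : DPG A V) (π : A → V) : Prop :=
  ∀ a b : A, a ≠ b →
    ¬ (Γ.cost π a > Γ.cost (swapAlloc π a b) a ∧ Γ.cost π b > Γ.cost (swapAlloc π a b) b)

/-- An allocation is jump stable if no agent strictly decreases their cost by
jumping to an empty vertex. -/
def DPG.JumpStable (Γ : DPG A V) (π : A → V) : Prop :=
  ∀ (a : A) (v : V), (∀ b : A, π b ≠ v) →
    ¬ (Γ.cost π a > Γ.cost (Function.update π a v) a)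


/-- A game has symmetric preferences if `b ∈ M_a` implies `a ∈ M_b` and `d_a(b) = d_b(a)`. -/
def DPG.Symmetric (Γ : DPG A V) : Prop :=
  ∀ a b : A, b ∈ Γ.M a → a ∈ Γ.M b ∧ Γ.d a b = Γ.d b a

/-- If a symmetric matrix vanishes outside the rows and columns of `a` and `b`, and on the
`2 × 2` block they span, then its total sum is twice the sum of rows `a` and `b`. -/
lemma sum_sum_eq_two_mul_rows {α : Type} [Fintype α] [DecidableEq α] (h : α → α → ℤ) {a b : α}
    (hab : a ≠ b) (hs : ∀ x y, h x y = h y x) (haa : h a a = 0) (hbb : h b b = 0)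
    (hba : h a b = 0) (h0 : ∀ x y, x ≠ a → x ≠ b → y ≠ a → y ≠ b → h x y = 0) :
    ∑ x, ∑ y, h x y = 2 * (∑ y, h a y + ∑ y, h b y) := by
  have key : ∀ x y, h x y = (if x = a then h a y else 0) + (if x = b then h b y else 0) +
      (if y = a then h a x else 0) + (if y = b then h b x else 0) := by
    intro x y
    grind
  calc ∑ x, ∑ y, h x y
      = ∑ x, ∑ y, ((if x = a then h a y else 0) + (if x = b then h b y else 0) +
          (if y = a then h a x else 0) + (if y = b then h b x else 0)) :=
        sum_congr rfl fun x _ => sum_congr rfl fun y _ => key x y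
    _ = (∑ y, h a y + ∑ y, h b y) + (∑ x, h a x + ∑ x, h b x) := by
        simp only [sum_add_distrib, sum_ite_eq', mem_univ, if_true]
        rw [sum_comm, sum_comm (f := fun x y => if x = b then h b y else 0)]
        simp only [sum_ite_eq', mem_univ, if_true]
        ring
    _ = _ := by ring

/-- The contribution of agent `y` to the cost of agent `x`. -/
noncomputable def DPG.pairCost (Γ : DPG A V) (π : A → V) (x y : A) : ℤ :=
  if y ∈ Γ.M x then |(Γ.d x y : ℤ) - (Γ.G.dist (π x) (π y) : ℤ)| else 0

lemma DPG.cost_eq_sum_pairCost (Γ : DPG A V) (π : A → V) (x : A) :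
    (Γ.cost π x : ℤ) = ∑ y, Γ.pairCost π x y := by
  simp [DPG.cost, DPG.pairCost]

lemma DPG.pairCost_self (Γ : DPG A V) (π : A → V) (x : A) : Γ.pairCost π x x = 0 :=
  if_neg (Γ.M_irr x)

lemma DPG.Symmetric.pairCost_comm {Γ : DPG A V} (hsym : Γ.Symmetric) (π : A → V) (x y : A) :
    Γ.pairCost π x y = Γ.pairCost π y x := by
  unfold DPG.pairCost
  rw [SimpleGraph.dist_comm]
  by_cases hy : y ∈ Γ.M x
  · obtain ⟨hx, hd⟩ := hsym x y hy
    simp [hx, hy, hd]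
  · have hx : x ∉ Γ.M y := fun hx => hy (hsym y x hx).1
    simp [hx, hy]

/-- Under symmetric preferences, a swap changes the total cost by twice the change in the costs
of the two swapping agents. -/
lemma DPG.Symmetric.sum_cost_sub_sum_cost_swapAlloc {Γ : DPG A V} (hsym : Γ.Symmetric)
    (π : A → V) {a b : A} (hab : a ≠ b) :
    (∑ x, (Γ.cost π x : ℤ)) - ∑ x, (Γ.cost (swapAlloc π a b) x : ℤ) =
      2 * (((Γ.cost π a : ℤ) - Γ.cost (swapAlloc π a b) a) +
        ((Γ.cost π b : ℤ) - Γ.cost (swapAlloc π a b) b)) := by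
  simp only [DPG.cost_eq_sum_pairCost, ← sum_sub_distrib]
  apply sum_sum_eq_two_mul_rows (fun x y => Γ.pairCost π x y - Γ.pairCost (swapAlloc π a b) x y) hab
  · intro x y
    rw [hsym.pairCost_comm π x y, hsym.pairCost_comm _ x y]
  · simp [DPG.pairCost_self]
  · simp [DPG.pairCost_self]
  · simp [DPG.pairCost, swapAlloc, SimpleGraph.dist_comm (u := π b)]
  · intro x y hxa hxb hya hyb
    simp [DPG.pairCost, swapAlloc, Equiv.swap_apply_of_ne_of_ne, *]

/-- Every distance preservation game with symmetric preferences admits a swap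
stable allocation. -/
theorem symmetric_exists_swapStable (Γ : DPG A V) (hsym : Γ.Symmetric) :
    ∃ π : A → V, Function.Injective π ∧ Γ.SwapStable π := by
  classical
  obtain ⟨f⟩ := Function.Embedding.nonempty_of_card_le Γ.card_le
  have : Nonempty {π : A → V // Function.Injective π} := ⟨⟨f, f.injective⟩⟩
  obtain ⟨⟨π, hπ⟩, hmin⟩ :=
    Finite.exists_min fun π : {π : A → V // Function.Injective π} => ∑ x, (Γ.cost π.1 x : ℤ)
  refine ⟨π, hπ, fun a b hab ⟨ha, hb⟩ => ?_⟩
  have hle := hmin ⟨swapAlloc π a b, hπ.comp (Equiv.swap a b).injective⟩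
  have hsub := hsym.sum_cost_sub_sum_cost_swapAlloc π hab
  dsimp only at hle
  omega
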